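/- Let λ_1 ≤ λ_2 ≤ λ_3 ≤ λ_4 be real numbers with λ_1 + λ_2 + λ_3 + λ_4 = 0, λ_1^2 + λ_2^2 + λ_3^2 + λ_4^2 = S > 0, and λ_1^3 + λ_2^3 + λ_3^3 + λ_4^3 = S^(3/2)/sqrt(3). Then λ_4 = 3λ and λ_1 = λ_2 = λ_3 = -λ where λ = sqrt(S/12). -/

import Mathlib

/-- Among four reals with zero sum, each is at most `3m` when the squares sum to `12 m ^ 2`. -/
theorem le_three_mul_of_sum_zero {x a b c m : ℝ} (hm : 0 ≤ m) (hsum : x + a + b + c = 0)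
    (hsq : x ^ 2 + a ^ 2 + b ^ 2 + c ^ 2 = 12 * m ^ 2) : x ≤ 3 * m := by
  have hx : x = -(a + b + c) := by linarith
  refine le_of_abs_le (abs_le_of_sq_le_sq (b := 3 * m) ?_ (by positivity))
  subst hx
  nlinarith [sq_nonneg (a - b), sq_nonneg (b - c), sq_nonneg (a - c)]

theorem sq_mul_sub_nonpos {x m : ℝ} (hx : x ≤ 3 * m) : (x + m) ^ 2 * (x - 3 * m) ≤ 0 :=
  mul_nonpos_of_nonneg_of_nonpos (sq_nonneg _) (by linarith)

theorem eq_neg_or_eq_three_mul {x m : ℝ} (h : (x + m) ^ 2 * (x - 3 * m) = 0) :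
    x = -m ∨ x = 3 * m := by
  rcases mul_eq_zero.mp h with h | h
  · exact Or.inl (by linarith [pow_eq_zero_iff two_ne_zero |>.mp h])
  · exact Or.inr (by linarith)

theorem rpow_three_halves_div_sqrt_three {S : ℝ} (hS : 0 < S) :
    S ^ ((3 : ℝ) / 2) / Real.sqrt 3 = 24 * Real.sqrt (S / 12) ^ 3 := by
  obtain ⟨m, hm, rfl⟩ : ∃ m : ℝ, 0 < m ∧ S = 12 * m ^ 2 :=
    ⟨Real.sqrt (S / 12), by positivity, by rw [Real.sq_sqrt (by positivity)]; ring⟩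
  have hroot : Real.sqrt (12 * m ^ 2) = 2 * m * Real.sqrt 3 := by
    rw [Real.sqrt_eq_iff_mul_self_eq_of_pos (by positivity)]
    nlinarith [Real.sq_sqrt (show (0 : ℝ) ≤ 3 by norm_num)]
  rw [show (3 : ℝ) / 2 = 1 + 1 / 2 by norm_num, Real.rpow_add hS, Real.rpow_one,
    ← Real.sqrt_eq_rpow, hroot, mul_div_cancel_left₀ _ (by norm_num : (12 : ℝ) ≠ 0),
    Real.sqrt_sq hm.le]
  field_simp
  ring


theorem extremal_A3_config (lam1 lam2 lam3 lam4 S : ℝ)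
    (h12 : lam1 ≤ lam2) (h23 : lam2 ≤ lam3) (h34 : lam3 ≤ lam4)
    (hsum : lam1 + lam2 + lam3 + lam4 = 0)
    (hS : lam1 ^ 2 + lam2 ^ 2 + lam3 ^ 2 + lam4 ^ 2 = S) (hSpos : 0 < S)
    (hA3 : lam1 ^ 3 + lam2 ^ 3 + lam3 ^ 3 + lam4 ^ 3 = S ^ ((3 : ℝ) / 2) / Real.sqrt 3) :
    lam4 = 3 * Real.sqrt (S / 12) ∧ lam1 = -Real.sqrt (S / 12) ∧
    lam2 = -Real.sqrt (S / 12) ∧ lam3 = -Real.sqrt (S / 12) := by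
  rw [rpow_three_halves_div_sqrt_three hSpos] at hA3
  have hm : 0 < Real.sqrt (S / 12) := by positivity
  have hSm : S = 12 * Real.sqrt (S / 12) ^ 2 := by
    rw [Real.sq_sqrt (by positivity)]
    ring
  generalize Real.sqrt (S / 12) = m at *
  rw [hSm] at hS
  have n1 := sq_mul_sub_nonpos (le_three_mul_of_sum_zero (x := lam1) (a := lam2) (b := lam3)
    (c := lam4) hm.le (by linarith) (by linarith))
  have n2 := sq_mul_sub_nonpos (le_three_mul_of_sum_zero (x := lam2) (a := lam1) (b := lam3)
    (c := lam4) hm.le (by linarith) (by linarith))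
  have n3 := sq_mul_sub_nonpos (le_three_mul_of_sum_zero (x := lam3) (a := lam1) (b := lam2)
    (c := lam4) hm.le (by linarith) (by linarith))
  have n4 := sq_mul_sub_nonpos (le_three_mul_of_sum_zero (x := lam4) (a := lam1) (b := lam2)
    (c := lam3) hm.le (by linarith) (by linarith))
  have htotal : (lam1 + m) ^ 2 * (lam1 - 3 * m) + (lam2 + m) ^ 2 * (lam2 - 3 * m) +
      (lam3 + m) ^ 2 * (lam3 - 3 * m) + (lam4 + m) ^ 2 * (lam4 - 3 * m) = 0 := by
    linear_combination hA3 - m * hS - 5 * m ^ 2 * hsum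
  rcases eq_neg_or_eq_three_mul (x := lam1) (m := m) (by linarith) with e1 | e1 <;>
  rcases eq_neg_or_eq_three_mul (x := lam2) (m := m) (by linarith) with e2 | e2 <;>
  rcases eq_neg_or_eq_three_mul (x := lam3) (m := m) (by linarith) with e3 | e3 <;>
  rcases eq_neg_or_eq_three_mul (x := lam4) (m := m) (by linarith) with e4 | e4 <;>
  first
  | exact ⟨e4, e1, e2, e3⟩
  | (exfalso; linarith)
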